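/- arXiv:2602.03436 — 4 statements merged into one kernel-verified Lean document; each statement's English description precedes it below -/
import Mathlib

section
/- For any two rooted unordered trees T1 and T2 of height exactly 2, T1 is subtree isomorphic to T2 if and only if χ(T1) ⊑ χ(T2). -/
/-- A rooted unordered tree: a root together with a (finite) list of child subtrees.
Since all tree notions below are invariant under permuting children, this represents
unordered trees. -/
inductive RTree : Type where
  | node : List RTree → RTree

namespace RTree

/-- The children of the root. -/
def children : RTree → List RTree
  | node cs => cs

/-- The height of a rooted tree: the maximum length of a root-to-vertex path. -/
def height : RTree → ℕ
  | node [] => 0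
  | node (c :: cs) => max (height c + 1) (height (node cs))

/-- `Emb T₁ T₂` means `T₁` is subtree isomorphic to `T₂` (written `T₁ ≼ T₂`):
some sub-multiset of the root's children of `T₂` matches the children of the root of
`T₁`, each child of `T₁` embedding into the matched child of `T₂`. -/
inductive Emb : RTree → RTree → Prop where
  | node {cs₁ cs₂ l : List RTree} :
      List.Forall₂ Emb cs₁ l → l.Subperm cs₂ → Emb (node cs₁) (node cs₂)

/-- Isomorphism of rooted unordered trees: mutual subtree isomorphism. -/
def Iso (T₁ T₂ : RTree) : Prop := Emb T₁ T₂ ∧ Emb T₂ T₁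

/-- For a rooted tree `T` (of height 2), `chi T` is the multiset
`{|ch(v)| + 1 : v ∈ ch(r(T))}`. -/
def chi (T : RTree) : Multiset ℕ :=
  ((T.children.map (fun c => c.children.length + 1) : List ℕ) : Multiset ℕ)

end RTree

/-- `MRel X Y` (written `X ⊑ Y`): there is a multiplicity-respecting injection
`ψ : X → Y` with `x ≤ ψ x` for every `x ∈ X`. -/
def MRel {α : Type*} [LE α] (X Y : Multiset α) : Prop :=
  ∃ Y' ≤ Y, Multiset.Rel (· ≤ ·) X Y'

namespace RTree

lemma height_lt_of_mem {c : RTree} : ∀ {cs : List RTree}, c ∈ cs →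
    c.height + 1 ≤ (node cs).height
  | d :: ds, h => by
    rw [height]
    rcases List.mem_cons.1 h with rfl | h
    · exact le_max_left _ _
    · exact (height_lt_of_mem h).trans (le_max_right _ _)

lemma emb_length {a b : RTree} (h : Emb a b) : a.children.length ≤ b.children.length := by
  cases h with
  | node h1 h2 => exact h1.length_eq.trans_le h2.length_le

lemma emb_leaf (b : RTree) : Emb (node []) b := by
  cases b with
  | node cs => exact Emb.node List.Forall₂.nil (List.nil_subperm)

lemma eq_leaf {a : RTree} (h : a.height = 0) : a = node [] := by
  rcases a with ⟨_ | ⟨c, cs⟩⟩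
  · rfl
  · rw [height] at h
    omega

lemma forall2_leaf : ∀ (l m : List RTree), (∀ x ∈ l, x = node []) → l.length = m.length →
    List.Forall₂ Emb l m
  | [], [], _, _ => List.Forall₂.nil
  | a :: l, b :: m, h, hl => by
    refine List.Forall₂.cons ?_ (forall2_leaf l m (fun x hx => h x (by simp [hx])) (by simpa using hl))
    rw [h a (by simp)]
    exact emb_leaf b

lemma emb_of_length {a b : RTree} (ha : a.height ≤ 1)
    (h : a.children.length ≤ b.children.length) : Emb a b := by
  rcases a with ⟨as⟩
  rcases b with ⟨bs⟩
  simp only [children] at h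
  refine Emb.node (l := bs.take as.length) (forall2_leaf _ _ ?_ (by simp [h]))
    (List.take_sublist _ _).subperm
  intro x hx
  have := height_lt_of_mem hx
  exact eq_leaf (by omega)

lemma exists_forall2_of_rel {α β : Type*} {R : α → β → Prop} : ∀ (l : List α) (Y : Multiset β),
    Multiset.Rel R (l : Multiset α) Y → ∃ m : List β, (m : Multiset β) = Y ∧ List.Forall₂ R l m
  | [], Y, h => ⟨[], by simpa [eq_comm] using h, List.Forall₂.nil⟩
  | a :: l, Y, h => by
    rw [← Multiset.cons_coe, Multiset.rel_cons_left] at h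
    obtain ⟨b, Z, hab, hZ, rfl⟩ := h
    obtain ⟨m, rfl, hm⟩ := exists_forall2_of_rel l Z hZ
    exact ⟨b :: m, rfl, List.Forall₂.cons hab hm⟩

lemma rel_of_forall2 {α β : Type*} {R : α → β → Prop} {l : List α} {m : List β}
    (h : List.Forall₂ R l m) : Multiset.Rel R (l : Multiset α) (m : Multiset β) := by
  induction h with
  | nil => exact Multiset.Rel.zero
  | cons h _ ih => exact Multiset.Rel.cons h ih

end RTree

open RTree in
/-- For any two rooted unordered trees `T₁` and `T₂` of height exactly `2`,
`T₁` is subtree isomorphic to `T₂` if and only if `χ(T₁) ⊑ χ(T₂)`. -/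
theorem emb_iff_mrel_chi (T₁ T₂ : RTree)
    (h₁ : T₁.height = 2) (h₂ : T₂.height = 2) :
    Emb T₁ T₂ ↔ MRel (chi T₁) (chi T₂) := by
  rcases T₁ with ⟨as⟩
  rcases T₂ with ⟨bs⟩
  simp only [chi, children, MRel]
  constructor
  · intro h
    cases h with
    | @node _ _ l hl hs =>
      refine ⟨((l.map (fun c => c.children.length + 1) : List ℕ) : Multiset ℕ), ?_, ?_⟩
      · exact Multiset.map_le_map (f := fun c : RTree => c.children.length + 1) (Multiset.coe_le.2 hs)
      · apply rel_of_forall2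
        rw [List.forall₂_map_left_iff, List.forall₂_map_right_iff]
        exact hl.imp (fun a b hab => Nat.succ_le_succ (emb_length hab))
  · rintro ⟨Y, hY, hR⟩
    obtain ⟨m, rfl, hm⟩ := exists_forall2_of_rel _ _ hR
    obtain ⟨m', hp, hsub⟩ := Multiset.coe_le.1 hY
    obtain ⟨l, hl, rfl⟩ := List.sublist_map_iff.1 hsub
    have hR' : Multiset.Rel (fun a b : RTree => a.children.length + 1 ≤ b.children.length + 1)
        (as : Multiset RTree) (l : Multiset RTree) := by
      rw [← Multiset.coe_eq_coe.2 hp, ← Multiset.map_coe, ← Multiset.map_coe,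
        Multiset.rel_map] at hR
      exact hR
    obtain ⟨k, hk, hf⟩ := exists_forall2_of_rel _ _ hR'
    refine Emb.node (l := k) ?_ ⟨l, (Multiset.coe_eq_coe.1 hk).symm, hl⟩
    have hf2 : List.Forall₂ (fun a b : RTree => a ∈ as ∧
        a.children.length + 1 ≤ b.children.length + 1) as k :=
      (List.forall₂_and_left _ _).2 ⟨fun _ h => h, hf⟩
    refine hf2.imp (fun a b hab => emb_of_length ?_ (by omega))
    have := height_lt_of_mem hab.1
    omega
end

section
/- Let 𝒯 be a multiset of rooted unordered trees each of height at most 2, and let T be a rooted tree with 𝒯(T) ≠ ∅. Then T is a closed tree of 𝒯 if and only if T ≅ T_mct, where T_mct is the (unique up to isomorphism) maximal common tree of 𝒯(T). -/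
namespace RTree

/-- `T` is a common tree of the multiset `𝒯`: it is subtree isomorphic to every member. -/
def CommonTree (𝒯 : Multiset RTree) (T : RTree) : Prop := ∀ R ∈ 𝒯, Emb T R

/-- `T` is a maximal common tree of `𝒯`: it is a common tree and there is no common
tree `T'` with `T ≼ T'` and `T ≇ T'`. -/
def MaxCommonTree (𝒯 : Multiset RTree) (T : RTree) : Prop :=
  CommonTree 𝒯 T ∧ ∀ T', CommonTree 𝒯 T' → Emb T T' → Iso T T'

/-- The height-`0` tree (a single leaf). -/
def leafT : RTree := .node []

/-- The star with `k` leaf children. -/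
def starT (k : ℕ) : RTree := .node (List.replicate k leafT)

/-- `χ⁻¹`: the rooted tree of height at most `2` whose root has one child with `x - 1`
leaf children for each entry `x` of the list `l`. -/
def treeOfList (l : List ℕ) : RTree := .node (l.map (fun x => starT (x - 1)))

end RTree

namespace RTree

open Classical in
/-- `𝒯(T)`: the sub-multiset of trees of `𝒯` that contain `T` as a subtree. -/
noncomputable def occSet (𝒯 : Multiset RTree) (T : RTree) : Multiset RTree :=
  𝒯.filter (fun R => Emb T R)

/-- The support of `T` in `𝒯`: the number of members of `𝒯` containing `T` as a
subtree. -/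
noncomputable def support (𝒯 : Multiset RTree) (T : RTree) : ℕ := (occSet 𝒯 T).card

/-- `T` is a closed tree of `𝒯`: every rooted tree `T'` with `T ≼ T'` and `T' ≇ T` has
strictly smaller support than `T`. -/
def Closed (𝒯 : Multiset RTree) (T : RTree) : Prop :=
  ∀ T' : RTree, Emb T T' → ¬ Iso T' T → support 𝒯 T' < support 𝒯 T

end RTree

namespace RTree

theorem forall₂_trans_mem {R : RTree → RTree → Prop} {a l m : List RTree}
    (h : ∀ x ∈ a, ∀ y z, R x y → R y z → R x z)
    (h₁ : List.Forall₂ R a l) (h₂ : List.Forall₂ R l m) : List.Forall₂ R a m := by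
  induction h₁ generalizing m with
  | nil => cases h₂; exact .nil
  | cons hxy _ ih =>
    cases h₂ with
    | cons hyz htl =>
      exact .cons (h _ (by simp) _ _ hxy hyz)
        (ih (fun x hx => h x (List.mem_cons_of_mem _ hx)) htl)

theorem sublist_forall₂ {R : RTree → RTree → Prop} {l b : List RTree}
    (h : l.Sublist b) : ∀ {m : List RTree}, List.Forall₂ R b m →
      ∃ m', List.Forall₂ R l m' ∧ m'.Sublist m := by
  induction h with
  | slnil => intro m hm; exact ⟨m, hm, List.Sublist.refl _⟩
  | cons a _ ih =>
    intro m hm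
    cases hm with
    | cons h1 h2 =>
      obtain ⟨m', h3, h4⟩ := ih h2
      exact ⟨m', h3, h4.cons _⟩
  | cons_cons a _ ih =>
    intro m hm
    cases hm with
    | cons h1 h2 =>
      obtain ⟨m', h3, h4⟩ := ih h2
      exact ⟨_, .cons h1 h3, h4.cons_cons _⟩

theorem subperm_forall₂ {R : RTree → RTree → Prop} {l b m : List RTree}
    (h : l.Subperm b) (hm : List.Forall₂ R b m) :
    ∃ m', List.Forall₂ R l m' ∧ m'.Subperm m := by
  obtain ⟨l', hp, hs⟩ := h
  obtain ⟨m₁, h1, h2⟩ := sublist_forall₂ hs hm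
  obtain ⟨m₂, h3, h4⟩ := List.perm_comp_forall₂ hp.symm h1
  exact ⟨m₂, h3, h4.subperm.trans h2.subperm⟩

theorem Emb.refl' : ∀ T : RTree, Emb T T
  | .node cs => by
    have ih : ∀ c ∈ cs, Emb c c := fun c hc => Emb.refl' c
    exact .node (List.forall₂_same.2 ih) (List.Subperm.refl _)

theorem Emb.trans' : ∀ A B C : RTree, Emb A B → Emb B C → Emb A C
  | .node a, B, C => by
    have ih : ∀ x ∈ a, ∀ y z, Emb x y → Emb y z → Emb x z :=
      fun x hx y z => Emb.trans' x y z
    intro h₁ h₂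
    cases h₁ with
    | node f₁ s₁ =>
      cases h₂ with
      | node f₂ s₂ =>
        obtain ⟨m', h3, h4⟩ := subperm_forall₂ s₁ f₂
        exact .node (forall₂_trans_mem ih f₁ h3) (h4.trans s₂)

theorem mem_occSet {𝒯 : Multiset RTree} {T R : RTree} :
    R ∈ occSet 𝒯 T ↔ R ∈ 𝒯 ∧ Emb T R := by
  classical
  simp [occSet]

end RTree

open RTree in
/-- Let `𝒯` be a multiset of rooted unordered trees each of height at most `2`, and let
`T` be a rooted tree with `𝒯(T) ≠ ∅`.  Then `T` is a closed tree of `𝒯` iff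
`T ≅ T_mct`, where `T_mct` is the (unique up to isomorphism) maximal common tree of
`𝒯(T)`. -/
theorem closed_iff_iso_maxCommonTree (𝒯 : Multiset RTree)
    (hh : ∀ R ∈ 𝒯, R.height ≤ 2) (T : RTree) (hne : occSet 𝒯 T ≠ 0) :
    Closed 𝒯 T ↔ ∃ M : RTree, MaxCommonTree (occSet 𝒯 T) M ∧ Iso T M := by
  classical
  constructor
  · intro hc
    refine ⟨T, ⟨fun R hR => (mem_occSet.1 hR).2, fun T' hT' hTT' => ?_⟩,
      Emb.refl' T, Emb.refl' T⟩
    by_contra hn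
    have hlt := hc T' hTT' (fun h => hn ⟨h.2, h.1⟩)
    have hle : occSet 𝒯 T ≤ occSet 𝒯 T' := by
      unfold occSet
      refine Multiset.le_filter.2 ⟨Multiset.filter_le _ _, fun R hR => hT' R hR⟩
    exact absurd (Multiset.card_le_card hle) (not_le.2 hlt)
  · rintro ⟨M, ⟨_, hmax⟩, hTM, hMT⟩ T' hTT' hn
    have hle : occSet 𝒯 T' ≤ occSet 𝒯 T := by
      unfold occSet
      exact Multiset.monotone_filter_right _ (fun R hR => Emb.trans' _ _ _ hTT' hR)
    by_contra hlt
    have heq : occSet 𝒯 T' = occSet 𝒯 T := Multiset.eq_of_le_of_card_le hle (not_lt.1 hlt)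
    have hi := hmax T' (fun R hR => (mem_occSet.1 (heq ▸ hR)).2) (Emb.trans' _ _ _ hMT hTT')
    exact hn ⟨Emb.trans' _ _ _ hi.2 hMT, hTT'⟩
end

section
/- For any 1 ≤ j, k ≤ m, the rooted tree ν^m_j is subtree isomorphic to ν^m_k if and only if j = k. -/
namespace RTree

/-- The gadget tree `ν^m_j`: a height-`2` tree whose root has `m − j + 1` children,
each with exactly `j` leaf children. -/
def nu (m j : ℕ) : RTree := .node (List.replicate (m - j + 1) (starT j))

end RTree

namespace RTree

theorem Emb.length_le {cs ds : List RTree} (h : Emb (.node cs) (.node ds)) :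
    cs.length ≤ ds.length := by
  cases h with
  | node h1 h2 => exact h1.length_eq ▸ h2.length_le

theorem forall₂_replicate {a b : RTree} (h : Emb a b) (n : ℕ) :
    List.Forall₂ Emb (List.replicate n a) (List.replicate n b) := by
  induction n with
  | zero => exact List.Forall₂.nil
  | succ n ih => exact List.Forall₂.cons h ih

theorem leafT_emb : Emb leafT leafT := Emb.node List.Forall₂.nil (List.Subperm.refl _)

theorem starT_emb (k : ℕ) : Emb (starT k) (starT k) :=
  Emb.node (forall₂_replicate leafT_emb k) (List.Subperm.refl _)

theorem nu_emb (m k : ℕ) : Emb (nu m k) (nu m k) :=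
  Emb.node (forall₂_replicate (starT_emb k) _) (List.Subperm.refl _)

theorem nu_emb_le {m j k : ℕ} (h : Emb (nu m j) (nu m k)) : j ≤ k := by
  unfold nu at h
  cases h with
  | node h1 h2 =>
    rw [List.replicate_succ] at h1
    cases h1 with
    | cons h3 h4 =>
      have hm := List.eq_of_mem_replicate (h2.subset List.mem_cons_self)
      subst hm
      simpa using h3.length_le

end RTree

open RTree in
/-- For any `1 ≤ j, k ≤ m`, the rooted tree `ν^m_j` is subtree isomorphic to `ν^m_k`
iff `j = k`. -/
theorem nu_emb_iff (m j k : ℕ) (hj1 : 1 ≤ j) (hjm : j ≤ m) (hk1 : 1 ≤ k) (hkm : k ≤ m) :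
    Emb (nu m j) (nu m k) ↔ j = k := by
  constructor
  · intro h
    have h1 := nu_emb_le h
    have h2 := Emb.length_le h
    simp only [List.length_replicate] at h2
    omega
  · rintro rfl
    exact nu_emb m j
end

section
/- For any two itemsets X1, X2 ⊆ {1, …, n}, the rooted ordered tree T(X1) is subtree isomorphic to T(X2) if and only if X1 ⊆ X2. -/
/-- A rooted ordered tree of height at most `2` is represented by the list
`(c₁, …, c_k)` recording, in order, the number of children of each child of the root.
`OEmb L₁ L₂` is subtree isomorphism (`T₁ ≼ T₂`) for such trees: `L₁` embeds as a
subsequence of `L₂` with each entry of `L₁` at most the corresponding entry of `L₂`. -/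
def OEmb : List ℕ → List ℕ → Prop := List.SublistForall₂ (· ≤ ·)

/-- For an itemset `X ⊆ {1, …, n}`, the ordered tree `T(X)`: its root has `n` children
`v₁, …, v_n` in order, where `v_i` has exactly one leaf child if `i ∈ X` and is itself
a leaf otherwise; i.e., the length-`n` indicator list of `X`. -/
def itemTree (n : ℕ) (X : Finset ℕ) : List ℕ :=
  (List.range n).map (fun i => if i + 1 ∈ X then 1 else 0)

/-- For any two itemsets `X₁, X₂ ⊆ {1, …, n}`, the rooted ordered tree `T(X₁)` is
subtree isomorphic to `T(X₂)` iff `X₁ ⊆ X₂`. -/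
theorem itemTree_emb_iff (n : ℕ) (X₁ X₂ : Finset ℕ)
    (h₁ : X₁ ⊆ Finset.Icc 1 n) (h₂ : X₂ ⊆ Finset.Icc 1 n) :
    OEmb (itemTree n X₁) (itemTree n X₂) ↔ X₁ ⊆ X₂ := by
  have key : OEmb (itemTree n X₁) (itemTree n X₂) ↔
      List.Forall₂ (· ≤ ·) (itemTree n X₁) (itemTree n X₂) := by
    unfold OEmb
    rw [List.sublistForall₂_iff]
    constructor
    · rintro ⟨l, hl, hs⟩
      have e : l = itemTree n X₂ := hs.eq_of_length (by
        rw [← hl.length_eq]; simp [itemTree])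
      exact e ▸ hl
    · intro h
      exact ⟨_, h, List.Sublist.refl _⟩
  rw [key]
  unfold itemTree
  rw [List.forall₂_map_left_iff, List.forall₂_map_right_iff, List.forall₂_same]
  constructor
  · intro h x hx
    have hm := Finset.mem_Icc.1 (h₁ hx)
    have := h (x - 1) (List.mem_range.2 (by omega))
    rw [show x - 1 + 1 = x by omega, if_pos hx] at this
    by_contra hc
    rw [if_neg hc] at this
    omega
  · intro h x _
    by_cases hx : x + 1 ∈ X₁
    · rw [if_pos hx, if_pos (h hx)]
    · rw [if_neg hx]
      exact Nat.zero_le _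
end
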